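/- Let p be an odd prime. For every subset A ⊆ F_p with |A| = δp and δ ≥ C p^{-1/8} (for a sufficiently large absolute constant C), there exist x ∈ F_p and y ∈ F_p with y ≠ 0 such that x, x+y, and x+y² all lie in A. -/

import Mathlib

open Finset

namespace QuadraticRoth

open ComplexConjugate

section General

variable {ι κ : Type*} [Fintype ι] [Fintype κ]

lemma norm_sum_mul_sq_le (x y : ι → ℂ) :
    ‖∑ i, x i * y i‖ ^ 2 ≤ (∑ i, ‖x i‖ ^ 2) * ∑ i, ‖y i‖ ^ 2 := by
  have h : ‖∑ i, x i * y i‖ ≤ ∑ i, ‖x i‖ * ‖y i‖ :=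
    (norm_sum_le _ _).trans_eq (by simp)
  calc ‖∑ i, x i * y i‖ ^ 2 ≤ (∑ i, ‖x i‖ * ‖y i‖) ^ 2 := by gcongr
    _ ≤ _ := sum_mul_sq_le_sq_mul_sq _ _ _

lemma sum_sum_mul_le_sqrt (f g : ι → κ → ℝ) :
    ∑ i, ∑ j, f i j * g i j ≤ √(∑ i, ∑ j, f i j ^ 2) * √(∑ i, ∑ j, g i j ^ 2) := by
  simp only [← Fintype.sum_prod_type']
  exact Real.sum_mul_le_sqrt_mul_sqrt _ _ _

lemma sum_norm_sum_sq (c : ι → κ → ℂ) :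
    ((∑ n, ‖∑ m, c n m‖ ^ 2 : ℝ) : ℂ) = ∑ m, ∑ m', ∑ n, c n m * conj (c n m') := by
  push_cast
  simp_rw [← Complex.mul_conj', map_sum, sum_mul_sum]
  rw [sum_comm]
  exact sum_congr rfl fun m _ => sum_comm

end General

lemma conj_char {G : Type*} [AddCommGroup G] [Finite G] (ψ : AddChar G ℂ) (x : G) :
    conj (ψ x) = ψ (-x) := (ψ.map_neg_eq_conj x).symm

variable {F : Type*} [Field F] [Fintype F]

lemma sum_comp_mul {M : Type*} [AddCommMonoid M] {t : F} (ht : t ≠ 0) (f : F → M) :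
    ∑ μ, f (t * μ) = ∑ μ, f μ :=
  Equiv.sum_comp (Equiv.mulLeft₀ t ht) f

lemma sum_comp_mul_right {M : Type*} [AddCommMonoid M] {t : F} (ht : t ≠ 0) (f : F → M) :
    ∑ μ, f (μ * t) = ∑ μ, f μ :=
  Equiv.sum_comp (Equiv.mulRight₀ t ht) f

/-- The multiplicative energy of a nonnegative function vanishing at `0`. -/
lemma sum_sq_sum_mul_le {b : F → ℝ} (hb : ∀ μ, 0 ≤ b μ) (h0 : b 0 = 0) :
    ∑ t, (∑ μ, b (t * μ) * b μ) ^ 2 ≤ (∑ μ, b μ ^ 2) * (∑ μ, b μ) ^ 2 := by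
  have h1 : ∀ t, ∑ μ, b (t * μ) * b μ ≤ ∑ μ, b μ ^ 2 := by
    intro t
    rcases eq_or_ne t 0 with rfl | ht
    · simp only [zero_mul, h0, sum_const_zero]
      positivity
    · calc ∑ μ, b (t * μ) * b μ ≤ ∑ μ, (b (t * μ) ^ 2 + b μ ^ 2) / 2 := by
            gcongr with μ _
            nlinarith [sq_nonneg (b (t * μ) - b μ)]
        _ = _ := by
            rw [← sum_div, sum_add_distrib, sum_comp_mul ht (fun μ => b μ ^ 2)]
            ring
  have h2 : ∑ t, ∑ μ, b (t * μ) * b μ = (∑ μ, b μ) ^ 2 := by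
    rw [sum_comm, sq, mul_sum]
    refine sum_congr rfl fun μ _ => ?_
    rw [← sum_mul]
    rcases eq_or_ne μ 0 with rfl | hμ
    · simp [h0]
    · rw [sum_comp_mul_right hμ b]
  rw [← h2, mul_sum]
  gcongr with t _
  rw [sq]
  have := sum_nonneg fun μ (_ : μ ∈ univ) => mul_nonneg (hb (t * μ)) (hb μ)
  exact mul_le_mul_of_nonneg_right (h1 t) this

lemma sum_sum_sub_add {M : Type*} [AddCommMonoid M] (hF : ringChar F ≠ 2) (f : F → F → M) :
    ∑ k, ∑ μ, f (μ - k) (μ + k) = ∑ m, ∑ m', f m m' := by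
  have h2 : (2 : F) ≠ 0 := Ring.two_ne_zero hF
  rw [← Fintype.sum_prod_type', ← Fintype.sum_prod_type']
  refine Fintype.sum_equiv
    { toFun := fun z : F × F => (z.2 - z.1, z.2 + z.1)
      invFun := fun z => ((z.2 - z.1) / 2, (z.1 + z.2) / 2)
      left_inv := fun z => by ext <;> simp <;> field_simp <;> ring
      right_inv := fun z => by ext <;> simp <;> field_simp <;> ring } _ _ fun z => rfl

lemma sum_sum_norm_sq_sub_add (hF : ringChar F ≠ 2) (α : F → ℂ) :
    ∑ k, ∑ μ, ‖α (μ - k) * conj (α (μ + k))‖ ^ 2 = (∑ m, ‖α m‖ ^ 2) ^ 2 := by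
  rw [sum_sum_sub_add hF (fun m m' => ‖α m * conj (α m')‖ ^ 2), sq, sum_mul_sum]
  simp [mul_pow]

lemma sum_norm_sub_add_le (α : F → ℂ) (k : F) :
    ∑ μ, ‖α (μ - k) * conj (α (μ + k))‖ ≤ ∑ m, ‖α m‖ ^ 2 := by
  calc _ ≤ ∑ μ, (‖α (μ - k)‖ ^ 2 + ‖α (μ + k)‖ ^ 2) / 2 := by
        gcongr with μ _
        rw [norm_mul, RCLike.norm_conj]
        nlinarith [sq_nonneg (‖α (μ - k)‖ - ‖α (μ + k)‖)]
    _ = _ := by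
        have h1 : ∑ μ, ‖α (μ - k)‖ ^ 2 = ∑ m, ‖α m‖ ^ 2 :=
          Equiv.sum_comp (Equiv.subRight k) (fun m => ‖α m‖ ^ 2)
        have h2 : ∑ μ, ‖α (μ + k)‖ ^ 2 = ∑ m, ‖α m‖ ^ 2 :=
          Equiv.sum_comp (Equiv.addRight k) (fun m => ‖α m‖ ^ 2)
        rw [← sum_div, sum_add_distrib, h1, h2]
        ring

lemma sum_norm_neg_le (α : F → ℂ) : ∑ k, ‖α (0 - k) * conj (α (0 + k))‖ ≤ ∑ m, ‖α m‖ ^ 2 := by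
  calc _ ≤ ∑ k, (‖α (-k)‖ ^ 2 + ‖α k‖ ^ 2) / 2 := by
        gcongr with k _
        rw [norm_mul, RCLike.norm_conj, zero_sub, zero_add]
        nlinarith [sq_nonneg (‖α (-k)‖ - ‖α k‖)]
    _ = _ := by
        have h1 : ∑ k, ‖α (-k)‖ ^ 2 = ∑ m, ‖α m‖ ^ 2 :=
          Equiv.sum_comp (Equiv.neg F) (fun m => ‖α m‖ ^ 2)
        rw [← sum_div, sum_add_distrib, h1]
        ring

variable [DecidableEq F]

variable (F) in
/-- The quadratic character with complex values. -/
noncomputable def chi : MulChar F ℂ := (quadraticChar F).ringHomComp (Int.castRingHom ℂ)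

lemma chi_apply (a : F) : chi F a = ((quadraticChar F a : ℤ) : ℂ) := rfl

lemma chi_zero : chi F 0 = 0 := by simp [chi_apply]

lemma chi_ne_zero {a : F} (h : a ≠ 0) : chi F a ≠ 0 := by
  rw [chi_apply]
  exact_mod_cast quadraticChar_eq_zero_iff.not.2 h

lemma chi_sq {a : F} (h : a ≠ 0) : chi F a ^ 2 = 1 := by
  rw [chi_apply]
  exact_mod_cast quadraticChar_sq_one h

lemma norm_chi {a : F} (h : a ≠ 0) : ‖chi F a‖ = 1 := by
  have := congrArg norm (chi_sq h)
  rw [norm_pow, norm_one] at this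
  exact (pow_eq_one_iff_of_nonneg (norm_nonneg _) two_ne_zero).1 this

lemma norm_chi_le (a : F) : ‖chi F a‖ ≤ 1 := by
  rcases eq_or_ne a 0 with rfl | h
  · simp [chi_zero]
  · exact (norm_chi h).le

lemma conj_chi (a : F) : conj (chi F a) = chi F a := by simp [chi_apply]

lemma chi_inv (a : F) : chi F a⁻¹ = chi F a := by
  rcases eq_or_ne a 0 with rfl | h
  · simp
  · have h1 : chi F a⁻¹ * chi F a = 1 := by rw [← map_mul, inv_mul_cancel₀ h, map_one]
    have h2 := chi_sq h
    apply mul_right_cancel₀ (chi_ne_zero h)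
    rw [h1, ← h2, sq]

variable {ψ : AddChar F ℂ}

lemma norm_gaussSum_sq (hF : ringChar F ≠ 2) (hψ : ψ.IsPrimitive) :
    ‖gaussSum (chi F) ψ‖ ^ 2 = Fintype.card F := by
  have hq : (chi F).IsQuadratic := (quadraticChar_isQuadratic F).comp _
  have h1 : chi F ≠ 1 := by
    intro h
    apply quadraticChar_ne_one hF
    ext a
    have := congrArg (fun f : MulChar F ℂ => f a) h
    simp only [chi_apply, MulChar.one_apply_coe] at this
    simpa using this
  rw [← norm_pow, gaussSum_sq h1 hq hψ, norm_mul, norm_chi (by simp)]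
  simp

lemma sum_char_mul (hψ : ψ.IsPrimitive) (b : F) :
    ∑ x, ψ (x * b) = if b = 0 then (Fintype.card F : ℂ) else 0 := by
  rw [AddChar.sum_mulShift b hψ]; simp

lemma sum_char_mul_sq (hF : ringChar F ≠ 2) (hψ : ψ.IsPrimitive) {a : F} (ha : a ≠ 0) :
    ∑ y, ψ (a * y ^ 2) = chi F a * gaussSum (chi F) ψ := by
  have h1 : ∑ y, ψ (a * y ^ 2) = ∑ x, (chi F x + 1) * ψ (a * x) := by
    rw [← sum_fiberwise univ (fun y : F => y ^ 2)]
    refine sum_congr rfl fun x _ => ?_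
    rw [sum_congr rfl (g := fun _ => ψ (a * x)) (by
      intro y hy; rw [(mem_filter.1 hy).2]), sum_const, nsmul_eq_mul]
    congr 1
    have := quadraticChar_card_sqrts hF x
    rw [chi_apply]
    have h2 : #{y : F | y ^ 2 = x} = {y : F | y ^ 2 = x}.toFinset.card := by
      congr 1; ext; simp
    rw [h2]
    exact_mod_cast this
  have h3 : ∑ x, ψ (a * x) = 0 := by
    have := sum_char_mul hψ a
    rw [if_neg ha] at this
    simpa [mul_comm] using this
  have h4 := gaussSum_mulShift (chi F) ψ (Units.mk0 a ha)
  rw [h1]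
  simp_rw [add_mul, one_mul, sum_add_distrib, h3, add_zero]
  rw [← h4, ← mul_assoc, Units.val_mk0, ← sq, chi_sq ha, one_mul]
  simp [gaussSum, AddChar.mulShift_apply]

lemma sum_char_quadratic (hF : ringChar F ≠ 2) (hψ : ψ.IsPrimitive) {θ θ' : F} (h : θ - θ' ≠ 0)
    (μ μ' : F) :
    ∑ ν, ψ ((ν + μ) ^ 2 * θ - (ν + μ') ^ 2 * θ') =
      chi F (θ - θ') * gaussSum (chi F) ψ * ψ (-(θ * θ' * (μ - μ') ^ 2 / (θ - θ'))) := by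
  rw [← sum_char_mul_sq hF hψ h, sum_mul,
    ← Equiv.sum_comp (Equiv.addRight ((μ * θ - μ' * θ') / (θ - θ')))
      (fun y => ψ ((θ - θ') * y ^ 2) * _)]
  refine sum_congr rfl fun ν _ => ?_
  rw [← AddChar.map_add_eq_mul, Equiv.coe_addRight]
  congr 1
  field_simp
  ring

/-- The kernel obtained from a product of two quadratic phases after evaluating a Gauss sum. -/
noncomputable def phi (ψ : AddChar F ℂ) (k μ t : F) : ℂ :=
  chi F (t ^ 2 - μ ^ 2) * ψ (-(2 * k * (t - μ) / (t + μ)))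

lemma norm_phi_le (k μ t : F) : ‖phi ψ k μ t‖ ≤ 1 := by
  rw [phi, norm_mul, ψ.norm_apply, mul_one]
  exact norm_chi_le _

lemma phi_smul {l : F} (hl : l ≠ 0) (k μ t : F) : phi ψ k (l * μ) (l * t) = phi ψ k μ t := by
  have h1 : (l * t) ^ 2 - (l * μ) ^ 2 = l ^ 2 * (t ^ 2 - μ ^ 2) := by ring
  have h2 : 2 * k * (l * t - l * μ) / (l * t + l * μ) = 2 * k * (t - μ) / (t + μ) := by
    rw [← mul_sub, ← mul_add, mul_left_comm, mul_div_mul_left _ _ hl]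
  rw [phi, phi, h1, h2, map_mul, map_pow, chi_sq hl, one_mul]

/-- Correlations of the columns of `phi`. -/
noncomputable def corr (ψ : AddChar F ℂ) (k s t : F) : ℂ :=
  ∑ μ, phi ψ k μ s * conj (phi ψ k μ t)

lemma norm_corr_le (k s t : F) : ‖corr ψ k s t‖ ≤ Fintype.card F := by
  refine (norm_sum_le _ _).trans ((sum_le_sum (g := fun _ => (1 : ℝ)) fun μ _ => ?_).trans (by simp))
  rw [norm_mul, RCLike.norm_conj]
  exact mul_le_one₀ (norm_phi_le _ _ _) (norm_nonneg _) (norm_phi_le _ _ _)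

lemma corr_eq_div {t : F} (ht : t ≠ 0) (k s : F) : corr ψ k s t = corr ψ k (s / t) 1 := by
  rw [corr, corr, ← Equiv.sum_comp (Equiv.mulLeft₀ t ht)]
  refine sum_congr rfl fun μ _ => ?_
  change phi ψ k (t * μ) s * conj (phi ψ k (t * μ) t) = _
  have h1 := phi_smul (ψ := ψ) ht k μ (s / t)
  have h2 := phi_smul (ψ := ψ) ht k μ 1
  rw [mul_div_cancel₀ _ ht] at h1
  rw [mul_one] at h2
  rw [h1, h2]

lemma sum_norm_sum_char_sq_le (hψ : ψ.IsPrimitive) {c : F → ℂ} (hc : ∀ μ, ‖c μ‖ ≤ 1) (ρ : F → F) :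
    ∑ k, ‖∑ μ, c μ * ψ (k * ρ μ)‖ ^ 2 ≤
      Fintype.card F * ∑ μ, ∑ ν, if c μ ≠ 0 ∧ c ν ≠ 0 ∧ ρ μ = ρ ν then (1 : ℝ) else 0 := by
  have h := sum_norm_sum_sq fun k μ => c μ * ψ (k * ρ μ)
  have h2 := congrArg norm h
  rw [Complex.norm_real, Real.norm_of_nonneg (by positivity)] at h2
  rw [h2]
  simp_rw [mul_sum]
  refine (norm_sum_le _ _).trans (sum_le_sum fun μ _ => (norm_sum_le _ _).trans
    (sum_le_sum fun ν _ => ?_))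
  have h3 : ∑ k, c μ * ψ (k * ρ μ) * conj (c ν * ψ (k * ρ ν)) =
      c μ * conj (c ν) * ∑ k, ψ (k * (ρ μ - ρ ν)) := by
    rw [mul_sum]
    refine sum_congr rfl fun k _ => ?_
    rw [map_mul (starRingEnd ℂ), conj_char, mul_sub, sub_eq_add_neg, AddChar.map_add_eq_mul]
    ring
  rw [h3, sum_char_mul hψ]
  by_cases h4 : c μ ≠ 0 ∧ c ν ≠ 0 ∧ ρ μ = ρ ν
  · rw [if_pos h4, if_pos (sub_eq_zero.2 h4.2.2), norm_mul, norm_mul, RCLike.norm_conj, mul_one]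
    simp only [Complex.norm_natCast]
    exact mul_le_of_le_one_left (by positivity) (mul_le_one₀ (hc _) (norm_nonneg _) (hc _))
  · rw [if_neg h4, mul_zero]
    apply le_of_eq
    rw [norm_eq_zero]
    by_cases h5 : c μ = 0
    · simp [h5]
    by_cases h6 : c ν = 0
    · simp [h6]
    have : ρ μ - ρ ν ≠ 0 := fun h => h4 ⟨h5, h6, sub_eq_zero.1 h⟩
    simp [this]

lemma sum_norm_corr_sq_le (hF : ringChar F ≠ 2) (hψ : ψ.IsPrimitive) :
    ∑ k, ∑ t, ‖corr ψ k t 1‖ ^ 2 ≤ 3 * (Fintype.card F : ℝ) ^ 3 := by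
  have h2 : (2 : F) ≠ 0 := Ring.two_ne_zero hF
  have key : ∀ t : F, ∑ k, ‖corr ψ k t 1‖ ^ 2 ≤ Fintype.card F * ∑ μ, ∑ ν,
      ((if t = 1 then (1 : ℝ) else 0) + (if μ = ν then 1 else 0) + if t = μ * ν then 1 else 0) := by
    intro t
    set c : F → ℂ := fun μ => chi F (t ^ 2 - μ ^ 2) * chi F (1 ^ 2 - μ ^ 2) with hc
    set ρ : F → F := fun μ => -(2 * (t - μ) / (t + μ)) + 2 * (1 - μ) / (1 + μ) with hρ
    have h1 : ∀ k, corr ψ k t 1 = ∑ μ, c μ * ψ (k * ρ μ) := by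
      intro k
      refine sum_congr rfl fun μ _ => ?_
      rw [phi, phi, map_mul, conj_chi, conj_char, mul_mul_mul_comm, ← AddChar.map_add_eq_mul]
      congr 2
      simp only [hρ]
      ring
    have hcn : ∀ μ, c μ ≠ 0 → t + μ ≠ 0 ∧ 1 + μ ≠ 0 := by
      intro μ h
      refine ⟨fun h0 => h ?_, fun h0 => h ?_⟩
      · simp [hc, sq_sub_sq, h0, chi_zero]
      · simp only [hc, sq_sub_sq, h0, chi_zero, zero_mul, mul_zero]
    simp_rw [h1]
    refine (sum_norm_sum_char_sq_le hψ (fun μ => ?_) ρ).trans ?_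
    · simp only [hc]
      rw [norm_mul]
      exact mul_le_one₀ (norm_chi_le _) (norm_nonneg _) (norm_chi_le _)
    · gcongr with μ _ ν _
      split_ifs with g g1 g2 g3 g2 g3 g1 g2 g3 g2 g3 <;> try norm_num
      obtain ⟨m1, m2, m3⟩ := g
      obtain ⟨m4, m5⟩ := hcn μ m1
      obtain ⟨m6, m7⟩ := hcn ν m2
      simp only [hρ] at m3
      field_simp at m3
      have h0 : 2 * ((t - 1) * (μ - ν) * (t - μ * ν)) = 0 := by linear_combination -m3
      simp only [mul_eq_zero, sub_eq_zero, h2, g1, g2, g3, or_self] at h0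
  rw [sum_comm]
  refine (sum_le_sum fun t _ => key t).trans ?_
  rw [← mul_sum]
  have e1 : ∑ t : F, ∑ μ : F, ∑ ν : F,
      ((if t = 1 then (1 : ℝ) else 0) + (if μ = ν then 1 else 0) + if t = μ * ν then 1 else 0)
      = 3 * (Fintype.card F : ℝ) ^ 2 := by
    simp only [sum_add_distrib]
    have : ∑ t : F, ∑ μ : F, ∑ ν : F, (if t = μ * ν then (1 : ℝ) else 0) =
        (Fintype.card F : ℝ) ^ 2 := by
      rw [sum_comm]
      simp_rw [sum_comm (s := univ) (t := univ) (f := fun (t ν : F) => if t = _ * ν then (1 : ℝ) else 0)]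
      simp [sq]
    rw [this]
    simp [sq]
    ring
  rw [e1]
  apply le_of_eq
  ring

lemma sum_sum_norm_sq_phi_le (hF : ringChar F ≠ 2) (hψ : ψ.IsPrimitive) {β : F → F → ℂ} {A : ℝ}
    (h1 : ∀ k, ∑ μ, ‖β k μ‖ ≤ A) (h2 : ∑ k, ∑ μ, ‖β k μ‖ ^ 2 ≤ A ^ 2)
    (h3 : ∑ k, ‖β k 0‖ ≤ A) :
    ∑ k, ∑ μ, ‖∑ t, β k t * phi ψ k μ t‖ ^ 2 ≤
      (√3 * (√(Fintype.card F)) ^ 3 + 2 * Fintype.card F) * A ^ 2 := by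
  set q : ℝ := (Fintype.card F : ℝ) with hq
  have hA : 0 ≤ A := (sum_nonneg fun _ _ => norm_nonneg _).trans h3
  set b : F → F → ℝ := fun k μ => if μ = 0 then 0 else ‖β k μ‖ with hb
  have hb0 : ∀ k μ, 0 ≤ b k μ := fun k μ => by simp only [hb]; split_ifs <;> positivity
  have hble : ∀ k μ, b k μ ≤ ‖β k μ‖ := fun k μ => by
    simp only [hb]; split_ifs <;> simp
  have step1 : ∀ k, ∑ μ, ‖∑ t, β k t * phi ψ k μ t‖ ^ 2 ≤
      ∑ s, ∑ t, ‖β k s‖ * ‖β k t‖ * ‖corr ψ k s t‖ := by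
    intro k
    have h := congrArg norm (sum_norm_sum_sq fun μ t => β k t * phi ψ k μ t)
    rw [Complex.norm_real, Real.norm_of_nonneg (by positivity)] at h
    rw [h]
    refine (norm_sum_le _ _).trans (sum_le_sum fun s _ => (norm_sum_le _ _).trans
      (sum_le_sum fun t _ => le_of_eq ?_))
    rw [← RCLike.norm_conj (β k t), ← norm_mul, ← norm_mul, corr, mul_sum]
    congr 1
    refine sum_congr rfl fun μ _ => ?_
    rw [map_mul]
    ring
  have step2 : ∀ k s t, ‖β k s‖ * ‖β k t‖ * ‖corr ψ k s t‖ ≤ b k s * b k t * ‖corr ψ k s t‖ +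
      ((if s = 0 then q * ‖β k 0‖ * ‖β k t‖ else 0) +
        (if t = 0 then q * ‖β k 0‖ * ‖β k s‖ else 0)) := by
    intro k s t
    have hc := norm_corr_le (ψ := ψ) k s t
    have hm : ‖β k s‖ * ‖β k t‖ * ‖corr ψ k s t‖ ≤ ‖β k s‖ * ‖β k t‖ * q := by gcongr
    have := norm_nonneg (β k 0)
    have hnn : ∀ x, 0 ≤ q * ‖β k 0‖ * ‖β k x‖ := fun x => by positivity
    by_cases hs : s = 0
    · subst hs
      simp only [hb, if_true]
      split_ifs <;> nlinarith [hnn 0, hnn t]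
    by_cases ht : t = 0
    · subst ht
      simp only [hb, if_true, hs, if_false]
      nlinarith [hnn 0, hnn s]
    simp [hb, hs, ht]
  have step3 : ∀ k, ∑ s, ∑ t, b k s * b k t * ‖corr ψ k s t‖ =
      ∑ t, (∑ μ, b k (t * μ) * b k μ) * ‖corr ψ k t 1‖ := by
    intro k
    simp_rw [sum_mul]
    rw [sum_comm, sum_comm (s := univ) (f := fun t μ => b k (t * μ) * b k μ * ‖corr ψ k t 1‖)]
    refine sum_congr rfl fun μ _ => ?_
    rcases eq_or_ne μ 0 with rfl | hμ
    · simp [hb]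
    · rw [← sum_comp_mul_right hμ]
      refine sum_congr rfl fun t _ => ?_
      rw [corr_eq_div hμ, mul_div_cancel_right₀ _ hμ]
  have step4 : ∑ k, ∑ s, ∑ t, b k s * b k t * ‖corr ψ k s t‖ ≤ √3 * √q ^ 3 * A ^ 2 := by
    simp_rw [step3]
    have e1 : ∑ k, ∑ t, (∑ μ, b k (t * μ) * b k μ) ^ 2 ≤ A ^ 4 := by
      calc _ ≤ ∑ k, (∑ μ, b k μ ^ 2) * (∑ μ, b k μ) ^ 2 := by
            gcongr with k _
            exact sum_sq_sum_mul_le (hb0 k) (by simp [hb])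
        _ ≤ ∑ k, (∑ μ, ‖β k μ‖ ^ 2) * A ^ 2 := by
            gcongr with k _ μ _
            · exact hble _ _
            · exact (sum_le_sum fun μ _ => hble k μ).trans (h1 k)
        _ ≤ A ^ 2 * A ^ 2 := by rw [← sum_mul]; gcongr
        _ = A ^ 4 := by ring
    refine (sum_sum_mul_le_sqrt _ _).trans ?_
    calc _ ≤ √(A ^ 4) * √(3 * q ^ 3) :=
          mul_le_mul (Real.sqrt_le_sqrt e1) (Real.sqrt_le_sqrt (sum_norm_corr_sq_le hF hψ))
            (by positivity) (by positivity)
      _ = _ := by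
        have h3 : √(A ^ 4) = A ^ 2 := by
          rw [show A ^ 4 = (A ^ 2) ^ 2 by ring, Real.sqrt_sq (by positivity)]
        have h4 : √(q ^ 3) = √q ^ 3 := by
          rw [Real.sqrt_eq_iff_mul_self_eq (by positivity) (by positivity), ← sq, ← pow_mul,
            mul_comm 3 2, pow_mul, Real.sq_sqrt (by positivity)]
        rw [h3, Real.sqrt_mul (by norm_num), h4]
        ring
  have step5 : ∑ k, ∑ s, ∑ t, ((if s = 0 then q * ‖β k 0‖ * ‖β k t‖ else 0) +
        (if t = 0 then q * ‖β k 0‖ * ‖β k s‖ else 0)) ≤ 2 * q * A ^ 2 := by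
    have : ∀ k, ∑ s, ∑ t, ((if s = 0 then q * ‖β k 0‖ * ‖β k t‖ else 0) +
        (if t = 0 then q * ‖β k 0‖ * ‖β k s‖ else 0)) = 2 * q * ‖β k 0‖ * ∑ μ, ‖β k μ‖ := by
      intro k
      simp only [sum_add_distrib]
      rw [sum_comm]
      simp only [sum_ite_eq', mem_univ, if_true, ← mul_sum]
      ring
    simp_rw [this]
    calc _ ≤ ∑ k, 2 * q * ‖β k 0‖ * A := by
          gcongr with k _
          exact h1 k
      _ = 2 * q * A * ∑ k, ‖β k 0‖ := by
          rw [mul_sum]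
          exact sum_congr rfl fun _ _ => by ring
      _ ≤ 2 * q * A * A := by gcongr
      _ = _ := by ring
  calc _ ≤ ∑ k, ∑ s, ∑ t, (b k s * b k t * ‖corr ψ k s t‖ +
      ((if s = 0 then q * ‖β k 0‖ * ‖β k t‖ else 0) +
        (if t = 0 then q * ‖β k 0‖ * ‖β k s‖ else 0))) :=
        sum_le_sum fun k _ => (step1 k).trans
          (sum_le_sum fun s _ => sum_le_sum fun t _ => step2 k s t)
    _ ≤ √3 * √q ^ 3 * A ^ 2 + 2 * q * A ^ 2 := by
        simp only [sum_add_distrib] at step4 step5 ⊢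
        gcongr
    _ = _ := by ring

lemma sum_char_sub_sq (hF : ringChar F ≠ 2) (hψ : ψ.IsPrimitive) {k μ μ' : F} (hk : k ≠ 0)
    (h1 : μ - k ≠ 0) (h2 : μ + k ≠ 0) (h3 : μ' - k ≠ 0) (h4 : μ' + k ≠ 0) :
    ∑ ν, ψ ((ν + μ) ^ 2 * ((μ - k)⁻¹ - (μ + k)⁻¹) - (ν + μ') ^ 2 * ((μ' - k)⁻¹ - (μ' + k)⁻¹)) =
      (if μ = μ' then (Fintype.card F : ℂ) else 0) +
      gaussSum (chi F) ψ * chi F (2 * k) * chi F (μ ^ 2 - k ^ 2) * chi F (μ' ^ 2 - k ^ 2) *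
        phi ψ k μ μ' := by
  have two : (2 : F) ≠ 0 := Ring.two_ne_zero hF
  rcases eq_or_ne μ μ' with rfl | hne
  · simp [phi, chi_zero]
  rw [if_neg hne, zero_add]
  have hd : μ - μ' ≠ 0 := sub_ne_zero.2 hne
  rcases eq_or_ne (μ' + μ) 0 with h0 | h0
  · obtain rfl : μ' = -μ := eq_neg_of_add_eq_zero_left h0
    have hμ : μ ≠ 0 := by rintro rfl; simp at hne
    simp only [phi, neg_sq, sub_self, chi_zero, zero_mul, mul_zero]
    have := sum_char_mul hψ (8 * k * μ / ((μ - k) * (μ + k)))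
    rw [if_neg (by
      have : (8 : F) = 2 ^ 3 := by norm_num
      rw [this]
      simp [two, hk, hμ, h1, h2])] at this
    rw [← this]
    refine sum_congr rfl fun ν _ => ?_
    congr 1
    field_simp
    ring
  have hdiff : (μ - k)⁻¹ - (μ + k)⁻¹ - ((μ' - k)⁻¹ - (μ' + k)⁻¹) =
      2 * k * (μ' ^ 2 - μ ^ 2) * ((μ ^ 2 - k ^ 2)⁻¹ * (μ' ^ 2 - k ^ 2)⁻¹) := by
    rw [sq_sub_sq μ k, sq_sub_sq μ' k]
    field_simp
    ring
  have hne2 : (μ - k)⁻¹ - (μ + k)⁻¹ - ((μ' - k)⁻¹ - (μ' + k)⁻¹) ≠ 0 := by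
    rw [hdiff, sq_sub_sq μ k, sq_sub_sq μ' k, sq_sub_sq μ' μ]
    have : μ' - μ ≠ 0 := sub_ne_zero.2 hne.symm
    simp [two, hk, h1, h2, h3, h4, h0, this]
  rw [sum_char_quadratic hF hψ hne2]
  have hphase : ((μ - k)⁻¹ - (μ + k)⁻¹) * ((μ' - k)⁻¹ - (μ' + k)⁻¹) * (μ - μ') ^ 2 /
      ((μ - k)⁻¹ - (μ + k)⁻¹ - ((μ' - k)⁻¹ - (μ' + k)⁻¹)) = 2 * k * (μ' - μ) / (μ' + μ) := by
    rw [div_eq_div_iff hne2 h0]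
    field_simp
    ring
  rw [hphase, hdiff, map_mul, map_mul, map_mul (chi F) (_⁻¹), chi_inv, chi_inv, phi]
  ring

lemma norm_gaussSum (hF : ringChar F ≠ 2) (hψ : ψ.IsPrimitive) :
    ‖gaussSum (chi F) ψ‖ = √(Fintype.card F) := by
  rw [← norm_gaussSum_sq hF hψ, Real.sqrt_sq (norm_nonneg _)]

lemma sum_norm_sum_mul_char_sq_eq (hF : ringChar F ≠ 2) (hψ : ψ.IsPrimitive) {k : F} (hk : k ≠ 0)
    {a b : F → ℂ} (ha : ∀ μ, a μ ≠ 0 → μ - k ≠ 0 ∧ μ + k ≠ 0)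
    (hb : ∀ μ, b μ = a μ * chi F (μ ^ 2 - k ^ 2)) :
    ((∑ ν, ‖∑ μ, a μ * ψ ((ν + μ) ^ 2 * ((μ - k)⁻¹ - (μ + k)⁻¹))‖ ^ 2 : ℝ) : ℂ) =
      ((Fintype.card F * ∑ μ, ‖a μ‖ ^ 2 : ℝ) : ℂ) + gaussSum (chi F) ψ * chi F (2 * k) *
        ∑ μ, b μ * ∑ t, conj (b t) * phi ψ k μ t := by
  rw [sum_norm_sum_sq]
  push_cast
  rw [mul_sum, mul_sum, ← sum_add_distrib]
  refine sum_congr rfl fun μ _ => ?_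
  have e1 : ∀ μ', ∑ ν, a μ * ψ ((ν + μ) ^ 2 * ((μ - k)⁻¹ - (μ + k)⁻¹)) *
      conj (a μ' * ψ ((ν + μ') ^ 2 * ((μ' - k)⁻¹ - (μ' + k)⁻¹))) =
      (if μ = μ' then Fintype.card F * (a μ * conj (a μ')) else 0) +
      gaussSum (chi F) ψ * chi F (2 * k) * (b μ * (conj (b μ') * phi ψ k μ μ')) := by
    intro μ'
    by_cases hz : a μ = 0
    · simp [hb, hz]
    by_cases hz' : a μ' = 0
    · simp [hb, hz']
    have e3 := sum_char_sub_sq hF hψ hk (ha μ hz).1 (ha μ hz).2 (ha μ' hz').1 (ha μ' hz').2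
    calc _ = a μ * conj (a μ') * ∑ ν, ψ ((ν + μ) ^ 2 * ((μ - k)⁻¹ - (μ + k)⁻¹) -
          (ν + μ') ^ 2 * ((μ' - k)⁻¹ - (μ' + k)⁻¹)) := by
          rw [mul_sum]
          refine sum_congr rfl fun ν _ => ?_
          rw [map_mul (starRingEnd ℂ), conj_char, sub_eq_add_neg _ ((ν + μ') ^ 2 * _),
            AddChar.map_add_eq_mul]
          ring
      _ = _ := by
          rw [e3, hb μ, hb μ', map_mul (starRingEnd ℂ), conj_chi]
          split_ifs <;> ring
  rw [sum_congr rfl fun μ' _ => e1 μ', sum_add_distrib, sum_ite_eq, if_pos (mem_univ _),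
    Complex.mul_conj', ← mul_sum, ← mul_sum]

lemma sum_norm_sum_mul_char_sq_le (hF : ringChar F ≠ 2) (hψ : ψ.IsPrimitive) {k : F} (hk : k ≠ 0)
    {a b : F → ℂ} (ha : ∀ μ, a μ ≠ 0 → μ - k ≠ 0 ∧ μ + k ≠ 0)
    (hb : ∀ μ, b μ = a μ * chi F (μ ^ 2 - k ^ 2)) :
    ∑ ν, ‖∑ μ, a μ * ψ ((ν + μ) ^ 2 * ((μ - k)⁻¹ - (μ + k)⁻¹))‖ ^ 2 ≤
      Fintype.card F * ∑ μ, ‖a μ‖ ^ 2 +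
        √(Fintype.card F) * ∑ μ, ‖b μ‖ * ‖∑ t, conj (b t) * phi ψ k μ t‖ := by
  have h2 := congrArg norm (sum_norm_sum_mul_char_sq_eq hF hψ hk ha hb)
  rw [Complex.norm_real, Real.norm_of_nonneg (by positivity)] at h2
  rw [h2]
  refine (norm_add_le _ _).trans (add_le_add (le_of_eq ?_) ?_)
  · rw [Complex.norm_real, Real.norm_of_nonneg (by positivity)]
  · rw [norm_mul, norm_mul, norm_gaussSum hF hψ, mul_assoc]
    gcongr
    refine (mul_le_of_le_one_left (norm_nonneg _) (norm_chi_le _)).trans ((norm_sum_le _ _).trans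
      (le_of_eq ?_))
    simp

/-- The bilinear form left after one application of Cauchy–Schwarz. -/
lemma sum_sum_norm_sum_quadratic_le (hF : ringChar F ≠ 2) (hψ : ψ.IsPrimitive) {α : F → ℂ}
    (h0 : α 0 = 0) :
    ∑ k, ∑ ν, ‖∑ μ, α (μ - k) * conj (α (μ + k)) *
        ψ ((ν + μ) ^ 2 * ((μ - k)⁻¹ - (μ + k)⁻¹))‖ ^ 2 ≤
      (2 * Fintype.card F + √(Fintype.card F) *
        √(√3 * (√(Fintype.card F)) ^ 3 + 2 * Fintype.card F)) * (∑ m, ‖α m‖ ^ 2) ^ 2 := by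
  set q : ℝ := (Fintype.card F : ℝ) with hq
  set A : ℝ := ∑ m, ‖α m‖ ^ 2 with hA
  have hA0 : 0 ≤ A := by positivity
  set a : F → F → ℂ := fun k μ => α (μ - k) * conj (α (μ + k)) with ha
  set β : F → F → ℂ := fun k μ => a k μ * chi F (μ ^ 2 - k ^ 2) with hβ
  have hβa : ∀ k μ, ‖β k μ‖ ≤ ‖a k μ‖ := fun k μ => by
    simp only [hβ]
    rw [norm_mul]
    exact mul_le_of_le_one_right (norm_nonneg _) (norm_chi_le _)
  have ha1 : ∀ k, ∑ μ, ‖a k μ‖ ≤ A := sum_norm_sub_add_le α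
  have ha2 : ∑ k, ∑ μ, ‖a k μ‖ ^ 2 = A ^ 2 := sum_sum_norm_sq_sub_add hF α
  have hβ1 : ∀ k, ∑ μ, ‖β k μ‖ ≤ A := fun k => (sum_le_sum fun μ _ => hβa k μ).trans (ha1 k)
  have hβ2 : ∑ k, ∑ μ, ‖β k μ‖ ^ 2 ≤ A ^ 2 := by
    rw [← ha2]
    gcongr with k _ μ _
    exact hβa k μ
  have hβ3 : ∑ k, ‖β k 0‖ ≤ A :=
    (sum_le_sum fun k _ => hβa k 0).trans (sum_norm_neg_le α)
  set D : F → F → ℂ := fun k μ => ∑ t, conj (β k t) * phi ψ k μ t with hD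
  have hZ : ∑ k, ∑ μ, ‖D k μ‖ ^ 2 ≤ (√3 * √q ^ 3 + 2 * q) * A ^ 2 :=
    sum_sum_norm_sq_phi_le hF hψ (by simpa using hβ1) (by simpa using hβ2) (by simpa using hβ3)
  have step : ∀ k, ∑ ν, ‖∑ μ, a k μ * ψ ((ν + μ) ^ 2 * ((μ - k)⁻¹ - (μ + k)⁻¹))‖ ^ 2 ≤
      (if k = 0 then q * A ^ 2 else 0) + q * ∑ μ, ‖a k μ‖ ^ 2 +
        √q * ∑ μ, ‖β k μ‖ * ‖D k μ‖ := by
    intro k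
    have hnn : 0 ≤ q * ∑ μ, ‖a k μ‖ ^ 2 := by positivity
    have hnn' : 0 ≤ √q * ∑ μ, ‖β k μ‖ * ‖D k μ‖ := by positivity
    by_cases hk : k = 0
    · rw [if_pos hk]
      have : ∑ ν, ‖∑ μ, a k μ * ψ ((ν + μ) ^ 2 * ((μ - k)⁻¹ - (μ + k)⁻¹))‖ ^ 2 ≤ q * A ^ 2 := by
        calc _ ≤ ∑ ν : F, A ^ 2 := by
              gcongr with ν _
              refine (norm_sum_le _ _).trans (le_trans (le_of_eq ?_) (ha1 k))
              simp
          _ = q * A ^ 2 := by simp [hq]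
      linarith
    rw [if_neg hk, zero_add]
    refine sum_norm_sum_mul_char_sq_le hF hψ hk (fun μ hμ => ⟨fun h => hμ ?_, fun h => hμ ?_⟩)
      fun μ => rfl
    · simp [ha, h, h0]
    · simp [ha, h, h0]
  have hcs : ∑ k, ∑ μ, ‖β k μ‖ * ‖D k μ‖ ≤ √(√3 * √q ^ 3 + 2 * q) * A ^ 2 := by
    refine (sum_sum_mul_le_sqrt (fun k μ => ‖β k μ‖) (fun k μ => ‖D k μ‖)).trans ?_
    calc _ ≤ √(A ^ 2) * √((√3 * √q ^ 3 + 2 * q) * A ^ 2) :=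
          mul_le_mul (Real.sqrt_le_sqrt hβ2) (Real.sqrt_le_sqrt hZ) (Real.sqrt_nonneg _)
            (Real.sqrt_nonneg _)
      _ = _ := by
          have hK : 0 ≤ √3 * √q ^ 3 + 2 * q := by positivity
          rw [Real.sqrt_mul hK, Real.sqrt_sq hA0]
          ring
  calc _ ≤ ∑ k, ((if k = 0 then q * A ^ 2 else 0) + q * ∑ μ, ‖a k μ‖ ^ 2 +
        √q * ∑ μ, ‖β k μ‖ * ‖D k μ‖) := sum_le_sum fun k _ => step k
    _ = q * A ^ 2 + q * A ^ 2 + √q * ∑ k, ∑ μ, ‖β k μ‖ * ‖D k μ‖ := by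
        rw [sum_add_distrib, sum_add_distrib, ← mul_sum, ← mul_sum, ha2]
        simp
    _ ≤ q * A ^ 2 + q * A ^ 2 + √q * (√(√3 * √q ^ 3 + 2 * q) * A ^ 2) := by gcongr
    _ = _ := by ring

/-- Second moment bound for the bilinear operator on the Fourier side, with the cardinality of the
field written as `r ^ 16`. -/
lemma sum_norm_bilinear_sq_le (hF : ringChar F ≠ 2) (hψ : ψ.IsPrimitive) {α : F → ℂ} (h0 : α 0 = 0)
    (G : F → ℂ) {r : ℝ} (hr : 1 ≤ r) (hq : (Fintype.card F : ℝ) = r ^ 16) :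
    ∑ s, ‖∑ m, α m * G (s - m) * ψ (s ^ 2 * m⁻¹)‖ ^ 2 ≤
      2 * r ^ 10 * (∑ m, ‖α m‖ ^ 2) * ∑ m, ‖G m‖ ^ 2 := by
  have hr0 : 0 ≤ r := by linarith
  have hK : 2 * (Fintype.card F : ℝ) + √(Fintype.card F) *
        √(√3 * (√(Fintype.card F)) ^ 3 + 2 * Fintype.card F) ≤ (2 * r ^ 10) ^ 2 := by
    have h1 : √(r ^ 16) = r ^ 8 := by
      rw [show r ^ 16 = (r ^ 8) ^ 2 by ring, Real.sqrt_sq (by positivity)]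
    have h3 : √3 ≤ (2 : ℝ) := by
      rw [Real.sqrt_le_left (by norm_num)]; norm_num
    have h4 : r ^ 16 ≤ r ^ 20 := pow_le_pow_right₀ hr (by norm_num)
    have h5 : r ^ 16 ≤ r ^ 24 := pow_le_pow_right₀ hr (by norm_num)
    rw [hq, h1]
    have h6 : √(√3 * (r ^ 8) ^ 3 + 2 * r ^ 16) ≤ 2 * r ^ 12 := by
      rw [Real.sqrt_le_left (by positivity)]
      calc √3 * (r ^ 8) ^ 3 + 2 * r ^ 16 ≤ 2 * (r ^ 8) ^ 3 + 2 * r ^ 24 := by gcongr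
        _ = _ := by ring
    calc 2 * r ^ 16 + r ^ 8 * √(√3 * (r ^ 8) ^ 3 + 2 * r ^ 16)
        ≤ 2 * r ^ 20 + r ^ 8 * (2 * r ^ 12) := by gcongr
      _ = _ := by ring
  have h := congrArg norm (sum_norm_sum_sq fun s m => α m * G (s - m) * ψ (s ^ 2 * m⁻¹))
  rw [Complex.norm_real, Real.norm_of_nonneg (by positivity), ← sum_sum_sub_add hF] at h
  have e1 : ∀ k, ∑ μ, ∑ s, α (μ - k) * G (s - (μ - k)) * ψ (s ^ 2 * (μ - k)⁻¹) *
      conj (α (μ + k) * G (s - (μ + k)) * ψ (s ^ 2 * (μ + k)⁻¹)) =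
      ∑ ν, (G (ν + k) * conj (G (ν - k))) * ∑ μ, α (μ - k) * conj (α (μ + k)) *
        ψ ((ν + μ) ^ 2 * ((μ - k)⁻¹ - (μ + k)⁻¹)) := by
    intro k
    simp_rw [mul_sum]
    rw [sum_comm (s := univ) (t := univ) (f := fun ν μ => (G (ν + k) * conj (G (ν - k))) * _)]
    refine sum_congr rfl fun μ _ => ?_
    rw [← Equiv.sum_comp (Equiv.addRight μ)]
    refine sum_congr rfl fun ν _ => ?_
    rw [Equiv.coe_addRight, map_mul (starRingEnd ℂ), map_mul (starRingEnd ℂ), conj_char,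
      mul_sub ((ν + μ) ^ 2), sub_eq_add_neg _ (_ * (μ + k)⁻¹),
      AddChar.map_add_eq_mul, show ν + μ - (μ - k) = ν + k by ring,
      show ν + μ - (μ + k) = ν - k by ring]
    ring
  rw [h]
  simp_rw [e1]
  have e2 : ∑ k, ∑ ν, ‖G (ν + k) * conj (G (ν - k))‖ ^ 2 = (∑ m, ‖G m‖ ^ 2) ^ 2 := by
    rw [← sum_sum_norm_sq_sub_add hF G]
    simp [mul_comm]
  have hY := (sum_sum_norm_sum_quadratic_le hF hψ h0).trans
    (mul_le_mul_of_nonneg_right hK (by positivity))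
  calc _ ≤ ∑ k, ∑ ν, ‖G (ν + k) * conj (G (ν - k))‖ * ‖∑ μ, α (μ - k) * conj (α (μ + k)) *
        ψ ((ν + μ) ^ 2 * ((μ - k)⁻¹ - (μ + k)⁻¹))‖ := by
        refine (norm_sum_le _ _).trans (sum_le_sum fun k _ => (norm_sum_le _ _).trans
          (le_of_eq (by simp only [norm_mul])))
    _ ≤ √((∑ m, ‖G m‖ ^ 2) ^ 2) * √((2 * r ^ 10) ^ 2 * (∑ m, ‖α m‖ ^ 2) ^ 2) := by
        refine (sum_sum_mul_le_sqrt _ _).trans ?_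
        rw [e2]
        exact mul_le_mul_of_nonneg_left (Real.sqrt_le_sqrt hY) (Real.sqrt_nonneg _)
    _ = _ := by
        rw [← mul_pow, Real.sqrt_sq (by positivity), Real.sqrt_sq (by positivity)]
        ring

/-- The unnormalised Fourier transform with respect to `e`. -/
noncomputable def fourier (e : AddChar F ℂ) (f : F → ℂ) (ξ : F) : ℂ := ∑ x, f x * e (ξ * x)

variable {e : AddChar F ℂ}

lemma sum_fourier_mul_char (he : e.IsPrimitive) (f : F → ℂ) (b : F) :
    ∑ n, fourier e f n * e (-(n * b)) = Fintype.card F * f b := by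
  simp_rw [fourier, sum_mul]
  rw [sum_comm]
  have : ∀ x, ∑ n, f x * e (n * x) * e (-(n * b)) =
      if x = b then Fintype.card F * f x else 0 := by
    intro x
    have := sum_char_mul he (x - b)
    simp_rw [sub_eq_zero] at this
    rw [show (if x = b then Fintype.card F * f x else 0 : ℂ) =
      f x * if x = b then (Fintype.card F : ℂ) else 0 by split_ifs <;> ring, ← this, mul_sum]
    refine sum_congr rfl fun n _ => ?_
    rw [mul_sub, sub_eq_add_neg, AddChar.map_add_eq_mul]
    ring
  simp [this]

lemma sum_norm_fourier_sq (he : e.IsPrimitive) (f : F → ℂ) :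
    ∑ ξ, ‖fourier e f ξ‖ ^ 2 = Fintype.card F * ∑ x, ‖f x‖ ^ 2 := by
  have h : ((∑ ξ, ‖fourier e f ξ‖ ^ 2 : ℝ) : ℂ) = (Fintype.card F * ∑ x, ‖f x‖ ^ 2 : ℝ) := by
    push_cast
    simp_rw [← Complex.mul_conj']
    rw [mul_sum]
    calc ∑ ξ, fourier e f ξ * conj (fourier e f ξ)
        = ∑ ξ, ∑ x, conj (f x) * (fourier e f ξ * e (-(ξ * x))) := by
          refine sum_congr rfl fun ξ _ => ?_
          conv_lhs => rw [fourier.eq_def e f ξ, map_sum, ← fourier.eq_def e f ξ, mul_sum]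
          refine sum_congr rfl fun x _ => ?_
          rw [map_mul, conj_char]
          ring
      _ = _ := by
          rw [sum_comm]
          refine sum_congr rfl fun x _ => ?_
          rw [← mul_sum, sum_fourier_mul_char he]
          ring
  exact_mod_cast h

lemma sum_char_neg_linear_quadratic (hF : ringChar F ≠ 2) (he : e.IsPrimitive) {m : F} (hm : m ≠ 0)
    (s : F) : ∑ y, e (-((s - m) * y) - m * y ^ 2) =
      chi F (-m) * gaussSum (chi F) e * (e (m * 4⁻¹) * e (-(s * 2⁻¹)) * e (4⁻¹ * (s ^ 2 * m⁻¹))) := by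
  have two : (2 : F) ≠ 0 := Ring.two_ne_zero hF
  have four : (4 : F) ≠ 0 := by
    have : (4 : F) = 2 ^ 2 := by norm_num
    rw [this]; exact pow_ne_zero _ two
  rw [← sum_char_mul_sq hF he (neg_ne_zero.2 hm), sum_mul,
    ← Equiv.sum_comp (Equiv.addRight ((s - m) / (2 * m)))
      (fun y => e (-m * y ^ 2) * _)]
  refine sum_congr rfl fun y _ => ?_
  rw [← AddChar.map_add_eq_mul, ← AddChar.map_add_eq_mul, ← AddChar.map_add_eq_mul,
    Equiv.coe_addRight]
  congr 1
  field_simp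
  ring

lemma fourier_expansion (hF : ringChar F ≠ 2) (he : e.IsPrimitive) (f : F → ℂ) :
    (Fintype.card F : ℂ) ^ 2 * ∑ x, ∑ y, f x * f (x + y) * f (x + y ^ 2) =
      Fintype.card F * (∑ x, f x) ^ 3 +
      ∑ s, (fourier e f (-s) * e (-(s * 2⁻¹))) *
        ∑ m, (chi F (-m) * gaussSum (chi F) e * e (m * 4⁻¹) * fourier e f m) *
          fourier e f (s - m) * e (4⁻¹ * (s ^ 2 * m⁻¹)) := by
  have h1 : (Fintype.card F : ℂ) ^ 2 * ∑ x, ∑ y, f x * f (x + y) * f (x + y ^ 2) =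
      ∑ m, ∑ s, fourier e f m * fourier e f (s - m) * fourier e f (-s) *
        ∑ y, e (-((s - m) * y) - m * y ^ 2) := by
    have hl : ∀ x y, (Fintype.card F : ℂ) ^ 2 * (f x * f (x + y) * f (x + y ^ 2)) =
        ∑ m, ∑ n, f x * (fourier e f m * e (-(m * (x + y ^ 2)))) *
          (fourier e f n * e (-(n * (x + y)))) := by
      intro x y
      simp_rw [← mul_sum]
      rw [← sum_mul, ← mul_sum, sum_fourier_mul_char he, sum_fourier_mul_char he]
      ring
    have hr : ∀ m, ∑ s, fourier e f m * fourier e f (s - m) * fourier e f (-s) *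
        ∑ y, e (-((s - m) * y) - m * y ^ 2) =
        ∑ n, ∑ x, ∑ y, f x * (fourier e f m * e (-(m * (x + y ^ 2)))) *
          (fourier e f n * e (-(n * (x + y)))) := by
      intro m
      rw [← Equiv.sum_comp (Equiv.addRight m)]
      refine sum_congr rfl fun n _ => ?_
      rw [Equiv.coe_addRight, add_sub_cancel_right, fourier.eq_def e f (-(n + m)), mul_assoc, sum_mul_sum,
        mul_sum]
      refine sum_congr rfl fun x _ => ?_
      rw [mul_sum]
      refine sum_congr rfl fun y _ => ?_
      have : e (-(n + m) * x) * e (-(n * y) - m * y ^ 2) =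
          e (-(m * (x + y ^ 2))) * e (-(n * (x + y))) := by
        rw [← AddChar.map_add_eq_mul, ← AddChar.map_add_eq_mul]
        congr 1
        ring
      linear_combination (fourier e f m * fourier e f n * f x) * this
    simp_rw [hr, mul_sum, hl]
    rw [sum_comm_cycle]
    exact sum_congr rfl fun m _ => sum_comm_cycle
  rw [h1]
  simp_rw [mul_sum]
  rw [sum_comm (s := univ) (t := univ)
    (f := fun s m => (fourier e f (-s) * e (-(s * 2⁻¹))) * (_ * _ * e (4⁻¹ * (s ^ 2 * m⁻¹))))]
  rw [← add_sum_erase univ _ (mem_univ (0 : F)), ← add_sum_erase univ (fun m => ∑ s,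
    (fourier e f (-s) * e (-(s * 2⁻¹))) * (_ * _ * e (4⁻¹ * (s ^ 2 * m⁻¹)))) (mem_univ (0 : F))]
  simp_rw [← mul_sum]
  have h2 : ∑ s, fourier e f 0 * fourier e f (s - 0) * fourier e f (-s) *
      ∑ y, e (-((s - 0) * y) - 0 * y ^ 2) = Fintype.card F * (∑ x, f x) ^ 3 := by
    have h3 : ∀ s : F, ∑ y, e (-((s - 0) * y) - 0 * y ^ 2) =
        if s = 0 then (Fintype.card F : ℂ) else 0 := by
      intro s
      have := sum_char_mul he (-s)
      simp only [neg_eq_zero] at this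
      rw [← this]
      refine sum_congr rfl fun y _ => ?_
      congr 1
      ring
    simp_rw [h3]
    simp [fourier]
    ring
  rw [h2]
  simp only [neg_zero, chi_zero, zero_mul, mul_zero, sum_const_zero, zero_add]
  congr 1
  refine sum_congr rfl fun m hm => sum_congr rfl fun s _ => ?_
  rw [sum_char_neg_linear_quadratic hF he (ne_of_mem_erase hm)]
  ring

lemma isPrimitive_mulShift {R : Type*} [CommRing R] [NoZeroDivisors R] {χ : AddChar R ℂ}
    (hχ : χ.IsPrimitive) {t : R} (ht : t ≠ 0) : (χ.mulShift t).IsPrimitive := by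
  intro a ha
  rw [AddChar.mulShift_mulShift]
  exact hχ (mul_ne_zero ht ha)

lemma exists_quadratic_progression (hF : ringChar F ≠ 2) (he : e.IsPrimitive) {r : ℝ} (hr : 1 ≤ r)
    (hq : (Fintype.card F : ℝ) = r ^ 16) {A : Finset F} (hA : 3 * r ^ 14 ≤ A.card) :
    ∃ x y, y ≠ 0 ∧ x ∈ A ∧ x + y ∈ A ∧ x + y ^ 2 ∈ A := by
  by_contra! hn
  have four : (4 : F)⁻¹ ≠ 0 := by
    have : (4 : F) = 2 ^ 2 := by norm_num
    rw [this]
    exact inv_ne_zero (pow_ne_zero _ (Ring.two_ne_zero hF))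
  have hr0 : 0 < r := by linarith
  set a : ℝ := (A.card : ℝ) with ha
  let f : F → ℂ := fun x => if x ∈ A then 1 else 0
  have hsum : ∑ x, f x = a := by simp [f, ha]
  have hnorm : ∑ ξ, ‖fourier e f ξ‖ ^ 2 = r ^ 16 * a := by
    rw [sum_norm_fourier_sq he, hq]
    simp [f, ha, apply_ite norm]
  have hQ : ∑ x, ∑ y, f x * f (x + y) * f (x + y ^ 2) = a := by
    rw [← hsum]
    refine sum_congr rfl fun x _ => ?_
    rw [sum_eq_single 0]
    · by_cases hx : x ∈ A <;> simp [f, hx]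
    · intro y _ hy
      by_cases h1 : x ∈ A
      · by_cases h2 : x + y ∈ A
        · simp [f, hn x y hy h1 h2]
        · simp [f, h2]
      · simp [f, h1]
    · simp
  have hqc : (Fintype.card F : ℂ) = (r ^ 16 : ℝ) := by rw [← hq]; simp
  have hexp := fourier_expansion hF he f
  rw [hQ, hsum, hqc, ← sub_eq_iff_eq_add'] at hexp
  have hα : ∑ m, ‖chi F (-m) * gaussSum (chi F) e * e (m * 4⁻¹) * fourier e f m‖ ^ 2 ≤
      r ^ 16 * (r ^ 16 * a) := by
    rw [← hnorm, mul_sum]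
    refine sum_le_sum fun m _ => ?_
    rw [norm_mul, norm_mul, norm_mul, AddChar.norm_apply, mul_one, mul_pow, mul_pow,
      norm_gaussSum_sq hF he, hq]
    have : ‖chi F (-m)‖ ^ 2 ≤ 1 := pow_le_one₀ (norm_nonneg _) (norm_chi_le _)
    have h0 : 0 ≤ r ^ 16 * ‖fourier e f m‖ ^ 2 := by positivity
    nlinarith
  have hH : ∑ s, ‖fourier e f (-s) * e (-(s * 2⁻¹))‖ ^ 2 = r ^ 16 * a := by
    rw [← hnorm, ← Equiv.sum_comp (Equiv.neg F)]
    simp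
  have hT := sum_norm_bilinear_sq_le hF (isPrimitive_mulShift he four)
    (α := fun m => chi F (-m) * gaussSum (chi F) e * e (m * 4⁻¹) * fourier e f m)
    (by simp [chi_zero]) (fourier e f) hr hq
  simp only [AddChar.mulShift_apply] at hT
  have hmain : (r ^ 32 * a - r ^ 16 * a ^ 3) ^ 2 ≤ 2 * r ^ 74 * a ^ 3 := by
    have h1 := norm_sum_mul_sq_le (fun s => fourier e f (-s) * e (-(s * 2⁻¹))) fun s =>
      ∑ m, (chi F (-m) * gaussSum (chi F) e * e (m * 4⁻¹) * fourier e f m) *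
          fourier e f (s - m) * e (4⁻¹ * (s ^ 2 * m⁻¹))
    rw [← hexp, hH] at h1
    have h2 : ((r ^ 16 : ℝ) : ℂ) ^ 2 * a - (r ^ 16 : ℝ) * (a : ℂ) ^ 3 =
        ((r ^ 32 * a - r ^ 16 * a ^ 3 : ℝ) : ℂ) := by
      push_cast
      ring
    rw [h2, Complex.norm_real, Real.norm_eq_abs, sq_abs] at h1
    calc _ ≤ _ := h1
      _ ≤ r ^ 16 * a * (2 * r ^ 10 * (r ^ 16 * (r ^ 16 * a)) * (r ^ 16 * a)) := by
        refine mul_le_mul_of_nonneg_left (hT.trans ?_) (by positivity)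
        rw [hnorm]
        gcongr
      _ = _ := by ring
  have ha0 : 0 < a := lt_of_lt_of_le (by positivity) hA
  have h1 : 9 * r ^ 28 ≤ a ^ 2 := by
    calc 9 * r ^ 28 = (3 * r ^ 14) ^ 2 := by ring
      _ ≤ a ^ 2 := by gcongr
  have h2 : 27 * r ^ 42 ≤ a ^ 3 := by
    calc 27 * r ^ 42 = (3 * r ^ 14) ^ 3 := by ring
      _ ≤ a ^ 3 := by gcongr
  have h3 : 2 * r ^ 16 ≤ a ^ 2 := by
    have : r ^ 16 ≤ r ^ 28 := pow_le_pow_right₀ hr (by norm_num)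
    nlinarith [pow_pos hr0 28]
  have h4 : r ^ 16 * a ^ 3 / 2 ≤ r ^ 16 * a ^ 3 - r ^ 32 * a := by
    have := mul_le_mul_of_nonneg_left h3 (by positivity : 0 ≤ r ^ 16 * a / 2)
    linear_combination this
  have h5 : (r ^ 16 * a ^ 3 / 2) ^ 2 ≤ 2 * r ^ 74 * a ^ 3 := by
    refine le_trans ?_ hmain
    rw [← neg_sq (r ^ 32 * a - _), neg_sub]
    gcongr
  have h6 := mul_le_mul_of_nonneg_left h2 (by positivity : 0 ≤ r ^ 32 * a ^ 3 / 4)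
  have h7 : 0 < r ^ 74 * a ^ 3 := by positivity
  nlinarith

end QuadraticRoth

theorem polynomial_roth_Fp :
    ∃ C : ℝ, 0 < C ∧ ∀ p : ℕ, p.Prime → Odd p → ∀ A : Finset (ZMod p),
      C * (p : ℝ) ^ ((7 : ℝ) / 8) ≤ A.card →
      ∃ x y : ZMod p, y ≠ 0 ∧ x ∈ A ∧ x + y ∈ A ∧ x + y ^ 2 ∈ A := by
  refine ⟨3, by norm_num, fun p hp hodd A hA => ?_⟩
  have : Fact p.Prime := ⟨hp⟩
  have hF : ringChar (ZMod p) ≠ 2 := by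
    rw [ZMod.ringChar_zmod_n]
    rintro rfl
    exact absurd hodd (by decide)
  have hp0 : (0 : ℝ) ≤ p := p.cast_nonneg
  refine QuadraticRoth.exists_quadratic_progression hF (ZMod.isPrimitive_stdAddChar p)
    (r := (p : ℝ) ^ ((1 : ℝ) / 16)) ?_ ?_ ?_
  · exact Real.one_le_rpow (by exact_mod_cast hp.one_lt.le) (by norm_num)
  · rw [ZMod.card, ← Real.rpow_natCast, ← Real.rpow_mul hp0]
    norm_num
  · rw [← Real.rpow_natCast, ← Real.rpow_mul hp0]
    convert hA using 3
    norm_num
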